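/- Let G be a real symmetric positive-semidefinite 3×3 matrix with eigenvalues λ₁ ≤ λ₂ ≤ λ₃, and let c₁, c₂ be constants with 0 < c₁ ≤ λ₁+λ₂ and λ₂+λ₃ ≤ c₂. Let R, R̄ ∈ SO(3), e_γ ∈ ℝ³, Q = R·R̄ᵀ, E_R = R − R̄, and for constants k_γ > 0 and 0 < μ < √(c₁/(4k_γ)) define V = ½⟨G·E_R, E_R⟩ + (1/(2k_γ))‖e_γ‖² + μ·⟨R·e_γ, (Q − Qᵀ)^∨⟩. Then, with z = (‖E_R‖, ‖e_γ‖) ∈ ℝ², M₁ = [[c₁/4, −(√2/2)μ], [−(√2/2)μ, 1/(2k_γ)]], and M₂ = [[c₂/4, (√2/2)μ], [(√2/2)μ, 1/(2k_γ)]], one has zᵀM₁z ≤ V ≤ zᵀM₂z, and the matrices M₁ and M₂ are positive definite. -/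

import Mathlib

open Matrix Polynomial

noncomputable section

/-- The hat map sending `x ∈ ℝ³` to the skew-symmetric matrix `x̂` with `x̂ y = x × y`. -/
def hat (x : Fin 3 → ℝ) : Matrix (Fin 3) (Fin 3) ℝ :=
  !![0, -x 2, x 1; x 2, 0, -x 0; -x 1, x 0, 0]

/-- The vee map, inverse of the hat map on skew-symmetric `3 × 3` matrices. -/
def vee (A : Matrix (Fin 3) (Fin 3) ℝ) : Fin 3 → ℝ :=
  ![A 2 1, A 0 2, A 1 0]

/-- `SO3 R` iff `R` is a rotation matrix: `RᵀR = I₃` and `det R = 1`. -/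
def SO3 (R : Matrix (Fin 3) (Fin 3) ℝ) : Prop :=
  Rᵀ * R = 1 ∧ R.det = 1

/-- Frobenius inner product `⟨A,B⟩ = tr(AᵀB)`. -/
def finner (A B : Matrix (Fin 3) (Fin 3) ℝ) : ℝ := (Aᵀ * B).trace

/-- Frobenius norm `‖A‖ = √⟨A,A⟩`. -/
def fnorm (A : Matrix (Fin 3) (Fin 3) ℝ) : ℝ := Real.sqrt (finner A A)

/-- Euclidean norm of a vector. -/
def vnorm {k : ℕ} (x : Fin k → ℝ) : ℝ := Real.sqrt (x ⬝ᵥ x)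

/-- Third standard basis vector `e₃ = (0,0,1)` of `ℝ³`. -/
def e3 : Fin 3 → ℝ := ![0, 0, 1]

/-- A rotation also satisfies `R Rᵀ = I₃`. -/
lemma SO3.mul_transpose {R : Matrix (Fin 3) (Fin 3) ℝ} (hR : SO3 R) : R * Rᵀ = 1 :=
  mul_eq_one_comm.mp hR.1

lemma SO3.transpose {R : Matrix (Fin 3) (Fin 3) ℝ} (hR : SO3 R) : SO3 Rᵀ :=
  ⟨by simpa using hR.mul_transpose, by simpa using hR.2⟩

lemma SO3.mul {A B : Matrix (Fin 3) (Fin 3) ℝ} (hA : SO3 A) (hB : SO3 B) : SO3 (A * B) := by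
  refine ⟨?_, by rw [det_mul, hA.2, hB.2, one_mul]⟩
  rw [transpose_mul, Matrix.mul_assoc, ← Matrix.mul_assoc Aᵀ, hA.1, Matrix.one_mul, hB.1]

/-- Conjugating a rotation by an orthogonal matrix gives a rotation. -/
lemma SO3.conj {W U : Matrix (Fin 3) (Fin 3) ℝ} (hW : SO3 W) (hU : U * Uᵀ = 1) :
    SO3 (Uᵀ * W * U) := by
  have hU' : Uᵀ * U = 1 := mul_eq_one_comm.mp hU
  refine ⟨?_, ?_⟩
  · calc (Uᵀ * W * U)ᵀ * (Uᵀ * W * U) = Uᵀ * Wᵀ * (U * Uᵀ) * W * U := by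
          simp only [transpose_mul, transpose_transpose, Matrix.mul_assoc]
      _ = Uᵀ * (Wᵀ * W) * U := by rw [hU]; simp only [Matrix.mul_one, Matrix.mul_assoc]
      _ = 1 := by rw [hW.1, Matrix.mul_one, hU']
  · have h := congrArg det hU'
    rw [det_mul, det_one] at h
    rw [det_mul, det_mul, hW.2, mul_one, h]

/-- A rotation equals its cofactor matrix. -/
lemma SO3.adjugate_eq {W : Matrix (Fin 3) (Fin 3) ℝ} (hW : SO3 W) : W.adjugate = Wᵀ := by
  calc W.adjugate = (Wᵀ * W) * W.adjugate := by rw [hW.1, Matrix.one_mul]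
    _ = Wᵀ := by rw [Matrix.mul_assoc, mul_adjugate, hW.2, one_smul, Matrix.mul_one]

lemma SO3.diag_cofactor {W : Matrix (Fin 3) (Fin 3) ℝ} (hW : SO3 W) :
    W 0 0 = W 1 1 * W 2 2 - W 1 2 * W 2 1 ∧ W 1 1 = W 0 0 * W 2 2 - W 0 2 * W 2 0 ∧
      W 2 2 = W 0 0 * W 1 1 - W 0 1 * W 1 0 := by
  have h := hW.adjugate_eq
  rw [adjugate_fin_three] at h
  have h0 := congrFun (congrFun h 0) 0
  have h1 := congrFun (congrFun h 1) 1
  have h2 := congrFun (congrFun h 2) 2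
  simp at h0 h1 h2
  exact ⟨by linarith, by linarith, by linarith⟩

lemma SO3.row_col_norms {W : Matrix (Fin 3) (Fin 3) ℝ} (hW : SO3 W) :
    (∀ i, W i 0 ^ 2 + W i 1 ^ 2 + W i 2 ^ 2 = 1) ∧
      ∀ j, W 0 j ^ 2 + W 1 j ^ 2 + W 2 j ^ 2 = 1 := by
  refine ⟨fun i => ?_, fun j => ?_⟩
  · have h := congrFun (congrFun hW.mul_transpose i) i
    simp [Matrix.mul_apply, Fin.sum_univ_three] at h
    linarith
  · have h := congrFun (congrFun hW.1 j) j
    simp [Matrix.mul_apply, Fin.sum_univ_three] at h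
    linarith

/-- The skew part of a rotation, in terms of its trace. -/
lemma SO3.vee_dot_self {W : Matrix (Fin 3) (Fin 3) ℝ} (hW : SO3 W) :
    vee (W - Wᵀ) ⬝ᵥ vee (W - Wᵀ) = (1 + W.trace) * (3 - W.trace) := by
  obtain ⟨c0, c1, c2⟩ := hW.diag_cofactor
  obtain ⟨hr, -⟩ := hW.row_col_norms
  have r0 := hr 0
  have r1 := hr 1
  have r2 := hr 2
  simp only [vee, dotProduct, Fin.sum_univ_three, trace_fin_three, Matrix.sub_apply,
    transpose_apply, cons_val_zero, cons_val_one, cons_val]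
  linear_combination r0 + r1 + r2 - 2 * c0 - 2 * c1 - 2 * c2

/-- The quantities `1 + Wᵢᵢ - Wⱼⱼ - Wₖₖ` are nonnegative: they are four times the squared vector
components of the unit quaternion of the rotation `W`. -/
lemma SO3.diag_le {W : Matrix (Fin 3) (Fin 3) ℝ} (hW : SO3 W) :
    0 ≤ 1 + W 0 0 - W 1 1 - W 2 2 ∧ 0 ≤ 1 + W 1 1 - W 0 0 - W 2 2 ∧
      0 ≤ 1 + W 2 2 - W 0 0 - W 1 1 := by
  obtain ⟨c0, c1, c2⟩ := hW.diag_cofactor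
  obtain ⟨hr, hc⟩ := hW.row_col_norms
  have r0 := hr 0
  have r1 := hr 1
  have r2 := hr 2
  have k0 := hc 0
  have k1 := hc 1
  have k2 := hc 2
  have p01 := sq_nonneg (W 2 1 - W 1 2)
  have p02 := sq_nonneg (W 0 2 - W 2 0)
  have p03 := sq_nonneg (W 1 0 - W 0 1)
  have p12 := sq_nonneg (W 0 1 + W 1 0)
  have p13 := sq_nonneg (W 0 2 + W 2 0)
  have p23 := sq_nonneg (W 1 2 + W 2 1)
  refine ⟨?_, ?_, ?_⟩
  · nlinarith [sq_nonneg (1 + W 0 0 - W 1 1 - W 2 2)]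
  · nlinarith [sq_nonneg (1 + W 1 1 - W 0 0 - W 2 2)]
  · nlinarith [sq_nonneg (1 + W 2 2 - W 0 0 - W 1 1)]

/-- Real spectral theorem with transposes, together with the information on the eigenvalues that
a factorization of the characteristic polynomial provides. -/
lemma exists_orthogonal_diagonalization {G : Matrix (Fin 3) (Fin 3) ℝ} (hG : G.IsHermitian)
    {l1 l2 l3 : ℝ} (hchar : G.charpoly = (X - C l1) * (X - C l2) * (X - C l3)) :
    ∃ (U : Matrix (Fin 3) (Fin 3) ℝ) (m : Fin 3 → ℝ), U * Uᵀ = 1 ∧ G = U * diagonal m * Uᵀ ∧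
      m 0 + m 1 + m 2 = l1 + l2 + l3 ∧ ∀ i, m i = l1 ∨ m i = l2 ∨ m i = l3 := by
  have hm : ∏ i, (X - C (hG.eigenvalues i)) = (X - C l1) * (X - C l2) * (X - C l3) := by
    rw [← hchar, hG.charpoly_eq]; simp
  refine ⟨hG.eigenvectorUnitary, hG.eigenvalues, ?_, ?_, ?_, fun i => ?_⟩
  · simpa [star_eq_conjTranspose] using Unitary.coe_mul_star_self hG.eigenvectorUnitary
  · have h := hG.spectral_theorem
    simpa [Unitary.conjStarAlgAut_apply, star_eq_conjTranspose, Function.comp_def] using h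
  · rw [Fin.prod_univ_three] at hm
    have e0 := congrArg (Polynomial.eval 0) hm
    have e1 := congrArg (Polynomial.eval 1) hm
    have e2 := congrArg (Polynomial.eval (-1)) hm
    simp at e0 e1 e2
    linarith
  · have h := congrArg (Polynomial.eval (hG.eigenvalues i)) hm
    rw [Polynomial.eval_prod, Finset.prod_eq_zero (Finset.mem_univ i) (by simp)] at h
    simp [sub_eq_zero] at h
    tauto

/-- Squared Frobenius distance of two rotations. -/
lemma finner_sub_self {R S : Matrix (Fin 3) (Fin 3) ℝ} (hR : SO3 R) (hS : SO3 S) :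
    finner (R - S) (R - S) = 2 * (3 - (R * Sᵀ).trace) := by
  have h : ((R - S)ᵀ * (R - S)) = Rᵀ * R + Sᵀ * S - Rᵀ * S - Sᵀ * R := by
    rw [transpose_sub]; noncomm_ring
  have h1 : (Rᵀ * S).trace = (R * Sᵀ).trace := by
    rw [← trace_transpose, transpose_mul, transpose_transpose, trace_mul_comm]
  have h2 : (Sᵀ * R).trace = (R * Sᵀ).trace := trace_mul_comm _ _
  rw [finner, h, hR.1, hS.1, trace_sub, trace_sub, trace_add, trace_one, h1, h2]
  norm_num
  ring

/-- The weighted squared distance of two rotations depends only on `R Sᵀ`. -/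
lemma finner_mul_sub_self {G R S : Matrix (Fin 3) (Fin 3) ℝ} (hG : Gᵀ = G) (hR : SO3 R)
    (hS : SO3 S) :
    finner (G * (R - S)) (R - S) = 2 * (G.trace - (G * (R * Sᵀ)).trace) := by
  have h : G * ((R - S) * (R - S)ᵀ) = G * (R * Rᵀ) + G * (S * Sᵀ) - G * (R * Sᵀ)
      - G * (S * Rᵀ) := by
    rw [transpose_sub]; noncomm_ring
  have h1 : (G * (S * Rᵀ)).trace = (G * (R * Sᵀ)).trace := by
    rw [← trace_transpose, transpose_mul, transpose_mul, transpose_transpose, hG, trace_mul_comm]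
  rw [finner, transpose_mul, hG, Matrix.mul_assoc, trace_mul_comm, Matrix.mul_assoc, h,
    hR.mul_transpose, hS.mul_transpose, trace_sub, trace_sub, trace_add, h1, Matrix.mul_one]
  ring

/-- If all sums of two eigenvalues of `G` lie in `[c₁, c₂]`, then `⟨G E, E⟩` is comparable to
`‖E‖²` for differences `E` of rotations. -/
lemma finner_mul_sub_self_bounds {G : Matrix (Fin 3) (Fin 3) ℝ} (hG : G.IsHermitian)
    {l1 l2 l3 : ℝ} (h12 : l1 ≤ l2) (h23 : l2 ≤ l3)
    (hchar : G.charpoly = (X - C l1) * (X - C l2) * (X - C l3))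
    {c₁ c₂ : ℝ} (hc₁ : c₁ ≤ l1 + l2) (hc₂ : l2 + l3 ≤ c₂)
    {R S : Matrix (Fin 3) (Fin 3) ℝ} (hR : SO3 R) (hS : SO3 S) :
    c₁ / 2 * finner (R - S) (R - S) ≤ finner (G * (R - S)) (R - S) ∧
      finner (G * (R - S)) (R - S) ≤ c₂ / 2 * finner (R - S) (R - S) := by
  have hGt : Gᵀ = G := by simpa [Matrix.IsHermitian] using hG
  obtain ⟨U, m, hU, hGU, hsum, hm⟩ := exists_orthogonal_diagonalization hG hchar
  have hU' : Uᵀ * U = 1 := mul_eq_one_comm.mp hU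
  have hlow : ∀ i, c₁ ≤ m 0 + m 1 + m 2 - m i := fun i => by
    rcases hm i with h | h | h <;> linarith
  have hupp : ∀ i, m 0 + m 1 + m 2 - m i ≤ c₂ := fun i => by
    rcases hm i with h | h | h <;> linarith
  set Q := R * Sᵀ with hQ
  have hW := (hR.mul hS.transpose).conj hU
  rw [← hQ] at hW
  have htrW : Q.trace = (Uᵀ * Q * U).trace := by
    rw [trace_mul_cycle, hU, Matrix.one_mul]
  have htrG : G.trace = m 0 + m 1 + m 2 := by
    rw [hGU, trace_mul_comm, ← Matrix.mul_assoc, hU', Matrix.one_mul, trace_diagonal,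
      Fin.sum_univ_three]
  have htrGQ : (G * Q).trace = (diagonal m * (Uᵀ * Q * U)).trace := by
    rw [hGU, Matrix.mul_assoc, Matrix.mul_assoc, trace_mul_comm]
    simp only [Matrix.mul_assoc]
  rw [finner_mul_sub_self hGt hR hS, finner_sub_self hR hS, ← hQ, htrG, htrGQ, htrW]
  generalize Uᵀ * Q * U = W at hW
  simp only [trace_fin_three, diagonal_mul]
  obtain ⟨b0, b1, b2⟩ := hW.diag_le
  have low0 := mul_nonneg b0 (sub_nonneg.mpr (hlow 0))
  have low1 := mul_nonneg b1 (sub_nonneg.mpr (hlow 1))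
  have low2 := mul_nonneg b2 (sub_nonneg.mpr (hlow 2))
  have upp0 := mul_nonneg b0 (sub_nonneg.mpr (hupp 0))
  have upp1 := mul_nonneg b1 (sub_nonneg.mpr (hupp 1))
  have upp2 := mul_nonneg b2 (sub_nonneg.mpr (hupp 2))
  constructor <;> nlinarith

lemma vnorm_sq {k : ℕ} (x : Fin k → ℝ) : vnorm x ^ 2 = x ⬝ᵥ x :=
  Real.sq_sqrt (by simpa using dotProduct_star_self_nonneg x)

lemma finner_self_nonneg (A : Matrix (Fin 3) (Fin 3) ℝ) : 0 ≤ finner A A := by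
  simpa [finner] using (posSemidef_conjTranspose_mul_self A).trace_nonneg

lemma fnorm_sq (A : Matrix (Fin 3) (Fin 3) ℝ) : fnorm A ^ 2 = finner A A :=
  Real.sq_sqrt (finner_self_nonneg A)

lemma sq_dotProduct_le {k : ℕ} (x y : Fin k → ℝ) : (x ⬝ᵥ y) ^ 2 ≤ (x ⬝ᵥ x) * (y ⬝ᵥ y) := by
  simpa [dotProduct, pow_two] using Finset.sum_mul_sq_le_sq_mul_sq Finset.univ x y

/-- Bound on the cross term of the Lyapunov function. -/
lemma abs_dotProduct_vee_le {R S : Matrix (Fin 3) (Fin 3) ℝ} (hR : SO3 R) (hS : SO3 S)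
    (e : Fin 3 → ℝ) :
    |R.mulVec e ⬝ᵥ vee (R * Sᵀ - (R * Sᵀ)ᵀ)| ≤ √2 * fnorm (R - S) * vnorm e := by
  have hnn : 0 ≤ √2 * fnorm (R - S) * vnorm e :=
    mul_nonneg (mul_nonneg (Real.sqrt_nonneg _) (Real.sqrt_nonneg _)) (Real.sqrt_nonneg _)
  refine abs_le_of_sq_le_sq ?_ hnn
  have hRe : R.mulVec e ⬝ᵥ R.mulVec e = e ⬝ᵥ e := by
    rw [dotProduct_mulVec, vecMul_mulVec, hR.1, vecMul_one]
  have hvee : vee (R * Sᵀ - (R * Sᵀ)ᵀ) ⬝ᵥ vee (R * Sᵀ - (R * Sᵀ)ᵀ) ≤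
      2 * finner (R - S) (R - S) := by
    rw [(hR.mul hS.transpose).vee_dot_self, finner_sub_self hR hS]
    nlinarith [sq_nonneg (3 - (R * Sᵀ).trace)]
  calc (R.mulVec e ⬝ᵥ vee (R * Sᵀ - (R * Sᵀ)ᵀ)) ^ 2
      ≤ (e ⬝ᵥ e) * (vee (R * Sᵀ - (R * Sᵀ)ᵀ) ⬝ᵥ vee (R * Sᵀ - (R * Sᵀ)ᵀ)) :=
        hRe ▸ sq_dotProduct_le _ _
    _ ≤ (e ⬝ᵥ e) * (2 * finner (R - S) (R - S)) := by
        gcongr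
        exact vnorm_sq e ▸ sq_nonneg _
    _ = (√2 * fnorm (R - S) * vnorm e) ^ 2 := by
        rw [mul_pow, mul_pow, fnorm_sq, vnorm_sq, Real.sq_sqrt (by norm_num)]
        ring

lemma dotProduct_mulVec_fin_two (a b d : ℝ) (x : Fin 2 → ℝ) :
    x ⬝ᵥ !![a, b; b, d].mulVec x = a * x 0 ^ 2 + 2 * b * x 0 * x 1 + d * x 1 ^ 2 := by
  simp [dotProduct, mulVec, Fin.sum_univ_two]
  ring

/-- A symmetric `2 × 2` matrix with positive corner and determinant is positive definite. -/
lemma posDef_fin_two {a b d : ℝ} (ha : 0 < a) (hdet : b ^ 2 < a * d) :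
    (!![a, b; b, d] : Matrix (Fin 2) (Fin 2) ℝ).PosDef := by
  refine PosDef.of_dotProduct_mulVec_pos ?_ fun x hx => ?_
  · ext i j
    fin_cases i <;> fin_cases j <;> rfl
  · rw [star_trivial, dotProduct_mulVec_fin_two]
    refine pos_of_mul_pos_right ?_ ha.le (a := a)
    have hsplit : a * (a * x 0 ^ 2 + 2 * b * x 0 * x 1 + d * x 1 ^ 2) =
        (a * x 0 + b * x 1) ^ 2 + (a * d - b ^ 2) * x 1 ^ 2 := by ring
    rw [hsplit]
    by_cases h1 : x 1 = 0
    · have h0 : x 0 ≠ 0 := fun h0 => hx (by ext i; fin_cases i <;> simp [h0, h1])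
      rw [h1]
      simp only [mul_zero, add_zero, ne_eq, OfNat.ofNat_ne_zero, not_false_eq_true, zero_pow]
      positivity
    · have := sub_pos.mpr hdet
      positivity

/-- the augmented Lyapunov function
`V = ½⟨G E_R, E_R⟩ + (1/(2k_γ))‖e_γ‖² + μ⟨R e_γ, (Q − Qᵀ)^∨⟩` satisfies
`zᵀM₁z ≤ V ≤ zᵀM₂z` with `z = (‖E_R‖, ‖e_γ‖)`, and `M₁, M₂` are positive definite. -/
theorem stmt_18 (G : Matrix (Fin 3) (Fin 3) ℝ) (hG : G.PosSemidef)
    (l1 l2 l3 : ℝ) (h12 : l1 ≤ l2) (h23 : l2 ≤ l3)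
    (hchar : G.charpoly = (X - C l1) * (X - C l2) * (X - C l3))
    (c₁ c₂ : ℝ) (hc₁ : 0 < c₁) (hc₁l : c₁ ≤ l1 + l2) (hc₂l : l2 + l3 ≤ c₂)
    (R Rbar : Matrix (Fin 3) (Fin 3) ℝ) (hR : SO3 R) (hRbar : SO3 Rbar)
    (eγ : Fin 3 → ℝ) (kγ μ : ℝ) (hkγ : 0 < kγ)
    (hμ0 : 0 < μ) (hμ : μ < Real.sqrt (c₁ / (4 * kγ)))
    (Q : Matrix (Fin 3) (Fin 3) ℝ) (hQ : Q = R * Rbarᵀ)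
    (V : ℝ)
    (hV : V = (1 / 2) * finner (G * (R - Rbar)) (R - Rbar) +
      (1 / (2 * kγ)) * vnorm eγ ^ 2 + μ * (R.mulVec eγ ⬝ᵥ vee (Q - Qᵀ)))
    (z : Fin 2 → ℝ) (hz : z = ![fnorm (R - Rbar), vnorm eγ])
    (M₁ M₂ : Matrix (Fin 2) (Fin 2) ℝ)
    (hM₁ : M₁ = !![c₁ / 4, -(Real.sqrt 2 / 2 * μ); -(Real.sqrt 2 / 2 * μ), 1 / (2 * kγ)])
    (hM₂ : M₂ = !![c₂ / 4, Real.sqrt 2 / 2 * μ; Real.sqrt 2 / 2 * μ, 1 / (2 * kγ)]) :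
    z ⬝ᵥ M₁.mulVec z ≤ V ∧ V ≤ z ⬝ᵥ M₂.mulVec z ∧ M₁.PosDef ∧ M₂.PosDef := by
  obtain ⟨hlow, hupp⟩ := finner_mul_sub_self_bounds hG.isHermitian h12 h23 hchar hc₁l hc₂l hR hRbar
  have hcross := abs_le.mp (abs_dotProduct_vee_le hR hRbar eγ)
  rw [← hQ] at hcross
  rw [← fnorm_sq] at hlow hupp
  have hcl := mul_le_mul_of_nonneg_left hcross.1 hμ0.le
  have hcu := mul_le_mul_of_nonneg_left hcross.2 hμ0.le
  have hc : c₁ ≤ c₂ := by linarith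
  have hμsq : μ ^ 2 < c₁ / (4 * kγ) := (Real.lt_sqrt hμ0.le).mp hμ
  have hoff : (√2 / 2 * μ) ^ 2 = μ ^ 2 / 2 := by
    rw [mul_pow, div_pow, Real.sq_sqrt (by norm_num)]
    ring
  have hdet : (√2 / 2 * μ) ^ 2 < c₁ / 4 * (1 / (2 * kγ)) := by
    have h : c₁ / 4 * (1 / (2 * kγ)) = c₁ / (4 * kγ) / 2 := by
      field_simp
    rw [hoff, h]
    linarith
  refine ⟨?_, ?_, ?_, ?_⟩
  · rw [hV, hz, hM₁, dotProduct_mulVec_fin_two]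
    simp only [cons_val_zero, cons_val_one]
    linarith
  · rw [hV, hz, hM₂, dotProduct_mulVec_fin_two]
    simp only [cons_val_zero, cons_val_one]
    linarith
  · rw [hM₁]
    exact posDef_fin_two (by linarith) (by rwa [neg_sq])
  · rw [hM₂]
    refine posDef_fin_two (by linarith) (hdet.trans_le ?_)
    gcongr
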